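/- arXiv:1502.04148 — 3 statements merged into one kernel-verified Lean document; each statement's English description precedes it below -/
import Mathlib

section
/- Let R be an n×n Hermitian positive semidefinite complex matrix and let P be a Moore–Penrose pseudoinverse of R. Let v ∈ ℂⁿ be a vector lying in the column space of R. Then vᴴ P v is a nonnegative real number, for every row vector b ∈ ℂ^{1×n} one has |b v|² ≤ (b R bᴴ) · (vᴴ P v), and equality holds for b = vᴴ P. -/
open Matrix
open scoped ComplexOrder

/-- The Cauchy–Schwarz inequality for the standard Hermitian product on `ι → ℂ`. -/
theorem normSq_star_dotProduct_le {ι : Type*} [Fintype ι] (x y : ι → ℂ) :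
    (Complex.normSq (star x ⬝ᵥ y) : ℂ) ≤ (star x ⬝ᵥ x) * (star y ⬝ᵥ y) := by
  have key (z w : ι → ℂ) :
      star z ⬝ᵥ w = inner ℂ (WithLp.toLp 2 z) (WithLp.toLp 2 w) := by
    rw [EuclideanSpace.inner_toLp_toLp, dotProduct_comm]
  rw [key, key, key, inner_self_eq_norm_sq_to_K, inner_self_eq_norm_sq_to_K,
    Complex.normSq_eq_norm_sq, ← mul_pow]
  have h := pow_le_pow_left₀ (norm_nonneg _)
    (norm_inner_le_norm (𝕜 := ℂ) (WithLp.toLp 2 x) (WithLp.toLp 2 y)) 2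
  exact Complex.real_le_real.mpr h |>.trans_eq (by push_cast; rfl)

open scoped MatrixOrder in
/-- The Cauchy–Schwarz inequality for the form defined by a positive semidefinite matrix. -/
theorem Matrix.PosSemidef.normSq_dotProduct_mulVec_le {ι : Type*} [Fintype ι]
    {R : Matrix ι ι ℂ} (hR : R.PosSemidef) (x y : ι → ℂ) :
    (Complex.normSq (star x ⬝ᵥ R *ᵥ y) : ℂ) ≤ (star x ⬝ᵥ R *ᵥ x) * (star y ⬝ᵥ R *ᵥ y) := by
  classical
  obtain ⟨C, rfl⟩ := CStarAlgebra.nonneg_iff_eq_star_mul_self.mp hR.nonneg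
  have key (z w : ι → ℂ) : star z ⬝ᵥ (star C * C) *ᵥ w = star (C *ᵥ z) ⬝ᵥ C *ᵥ w := by
    rw [star_eq_conjTranspose, ← mulVec_mulVec, dotProduct_mulVec, star_mulVec]
  simpa only [key] using normSq_star_dotProduct_le (C *ᵥ x) (C *ᵥ y)

/-- generalized Cauchy–Schwarz for a PSD matrix `R` with
Moore–Penrose pseudoinverse `P` and `v` in the column space of `R`:
`vᴴ P v` is a nonnegative real, `|b v|² ≤ (b R bᴴ)(vᴴ P v)` for every row
vector `b`, with equality at `b = vᴴ P`. -/
theorem stmt3 {n : ℕ} (R P : Matrix (Fin n) (Fin n) ℂ) (hR : R.PosSemidef)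
    (hP1 : R * P * R = R) (hP2 : P * R * P = P)
    (hP3 : (R * P)ᴴ = R * P) (hP4 : (P * R)ᴴ = P * R)
    (v : Fin n → ℂ) (hv : ∃ w : Fin n → ℂ, R *ᵥ w = v) :
    0 ≤ star v ⬝ᵥ P *ᵥ v ∧
    (∀ b : Fin n → ℂ,
      (Complex.normSq (b ⬝ᵥ v) : ℂ) ≤ (b ⬝ᵥ R *ᵥ star b) * (star v ⬝ᵥ P *ᵥ v)) ∧
    (Complex.normSq (Matrix.vecMul (star v) P ⬝ᵥ v) : ℂ) =
      (Matrix.vecMul (star v) P ⬝ᵥ R *ᵥ star (Matrix.vecMul (star v) P)) *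
        (star v ⬝ᵥ P *ᵥ v) := by
  obtain ⟨w, rfl⟩ := hv
  have hq : star (R *ᵥ w) ⬝ᵥ P *ᵥ (R *ᵥ w) = star w ⬝ᵥ R *ᵥ w := by
    rw [star_mulVec, hR.isHermitian.eq, ← dotProduct_mulVec, mulVec_mulVec, mulVec_mulVec,
      hP1]
  have hPH : R * Pᴴ * R = R := by
    simpa [hR.isHermitian.eq, mul_assoc] using congrArg conjTranspose hP1
  have hq' : Matrix.vecMul (star (R *ᵥ w)) P ⬝ᵥ
      R *ᵥ star (Matrix.vecMul (star (R *ᵥ w)) P) = star w ⬝ᵥ R *ᵥ w := by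
    rw [star_vecMul, star_star, star_mulVec, hR.isHermitian.eq, vecMul_vecMul,
      ← dotProduct_mulVec]
    simp only [mulVec_mulVec]
    rw [← mul_assoc R Pᴴ R, hPH, hP1]
  have hnonneg := hR.dotProduct_mulVec_nonneg w
  refine ⟨hq ▸ hnonneg, fun b => ?_, ?_⟩
  · simpa only [hq, star_star] using hR.normSq_dotProduct_mulVec_le (star b) w
  · rw [hq', ← dotProduct_mulVec, hq, Complex.normSq_eq_conj_mul_self,
      starRingEnd_apply, hnonneg.isSelfAdjoint.star_eq]
end

section
/- Let A be an n×m complex matrix with linearly independent columns (m ≤ n), let D be an m×m real diagonal matrix with nonzero diagonal entries d₁₁,…,d_mm, let C = Ā D Aᵀ (where Ā is the entrywise complex conjugate of A), and let P be a Moore–Penrose pseudoinverse of C. Then for all k, j ∈ {1,…,m} with k ≠ j, A_kᵀ P Ā_j = 0, and for every k, A_kᵀ P Ā_k = 1/d_kk, where A_k denotes the k-th column of A. -/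
open Matrix

/-- A matrix over a field with linearly independent columns has a left inverse. -/
theorem Matrix.exists_mul_eq_one_of_linearIndependent_col {K ι κ : Type*} [Field K]
    [Fintype ι] [Fintype κ] [DecidableEq ι] [DecidableEq κ] {A : Matrix ι κ K}
    (hA : LinearIndependent K A.col) : ∃ L : Matrix κ ι K, L * A = 1 := by
  obtain ⟨g, hg⟩ := LinearMap.exists_leftInverse_of_injective A.mulVecLin
    (LinearMap.ker_eq_bot.2 (Matrix.mulVec_injective_iff.2 hA))
  refine ⟨LinearMap.toMatrix' g, ?_⟩
  have h := congrArg LinearMap.toMatrix' hg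
  rwa [LinearMap.toMatrix'_comp, ← Matrix.toLin'_apply', LinearMap.toMatrix'_toLin',
    LinearMap.toMatrix'_id] at h

/-- An inner inverse of `B * D * T`, with `B` left invertible, `T` right invertible and `D`
invertible, compresses to the inverse of `D`. -/
theorem Matrix.mul_mul_eq_inv_of_inner_inverse {R ι κ : Type*} [CommRing R]
    [Fintype ι] [Fintype κ] [DecidableEq κ] {B : Matrix ι κ R} {T : Matrix κ ι R}
    {D E : Matrix κ κ R} {P : Matrix ι ι R} {L : Matrix κ ι R} {S : Matrix ι κ R}
    (hL : L * B = 1) (hS : T * S = 1) (hED : E * D = 1) (hDE : D * E = 1)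
    (hP : B * D * T * P * (B * D * T) = B * D * T) : T * P * B = E := by
  calc T * P * B = E * D * (T * P * B) * (D * E) := by rw [hED, hDE, one_mul, mul_one]
    _ = E * (L * B) * D * (T * P * B) * D * (T * S) * E := by
      rw [hL, hS, mul_one, mul_one]; simp only [Matrix.mul_assoc]
    _ = E * L * (B * D * T * P * (B * D * T)) * S * E := by simp only [Matrix.mul_assoc]
    _ = E * (L * B) * D * (T * S) * E := by rw [hP]; simp only [Matrix.mul_assoc]
    _ = E := by rw [hL, hS, mul_one, mul_one, hED, one_mul]

/-- complex pseudo-Euclidean orthogonality. With `C = Ā D Aᵀ`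
(`D` real diagonal, nonzero entries) and `P` a Moore–Penrose pseudoinverse of
`C`: `A_kᵀ P Ā_j = 0` for `k ≠ j`, and `A_kᵀ P Ā_k = 1 / d_kk`. -/
theorem stmt12 {n m : ℕ} (hmn : m ≤ n) (A : Matrix (Fin n) (Fin m) ℂ)
    (hA : LinearIndependent ℂ (fun j => Aᵀ j))
    (d : Fin m → ℝ) (hd : ∀ k, d k ≠ 0)
    (C P : Matrix (Fin n) (Fin n) ℂ)
    (hC : C = A.map star * Matrix.diagonal (fun k => (d k : ℂ)) * Aᵀ)
    (hP1 : C * P * C = C) (hP2 : P * C * P = P)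
    (hP3 : (C * P)ᴴ = C * P) (hP4 : (P * C)ᴴ = P * C) :
    (∀ k j : Fin m, k ≠ j → Aᵀ k ⬝ᵥ P *ᵥ star (Aᵀ j) = 0) ∧
    (∀ k : Fin m, Aᵀ k ⬝ᵥ P *ᵥ star (Aᵀ k) = 1 / (d k : ℂ)) := by
  obtain ⟨L, hL⟩ := Matrix.exists_mul_eq_one_of_linearIndependent_col (A := A) hA
  have hT : Aᵀ * Lᵀ = 1 := by rw [← Matrix.transpose_mul, hL, Matrix.transpose_one]
  have hB : L.map star * A.map star = 1 :=
    (Matrix.map_mul (f := starRingEnd ℂ) (L := L) (M := A)).symm.trans (by rw [hL]; simp)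
  have hd' : ∀ k, (d k : ℂ) ≠ 0 := fun k => Complex.ofReal_ne_zero.2 (hd k)
  have key : Aᵀ * P * A.map star = Matrix.diagonal (fun k => (d k : ℂ)⁻¹) := by
    refine Matrix.mul_mul_eq_inv_of_inner_inverse hB hT
      (D := Matrix.diagonal fun k => (d k : ℂ)) ?_ ?_ (hC ▸ hP1) <;>
    simp [Matrix.diagonal_mul_diagonal, hd']
  have entry : ∀ k j, Aᵀ k ⬝ᵥ P *ᵥ star (Aᵀ j) =
      Matrix.diagonal (fun k => (d k : ℂ)⁻¹) k j := by
    intro k j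
    rw [← key, Matrix.mul_assoc]
    rfl
  exact ⟨fun k j hkj => by rw [entry, Matrix.diagonal_apply_ne _ hkj],
    fun k => by rw [entry, Matrix.diagonal_apply_eq, one_div]⟩
end

section
/- Let A be an n×m complex matrix with linearly independent columns (m ≤ n), let D be an m×m real diagonal matrix with nonzero diagonal entries d₁₁,…,d_mm, let C = Ā D Aᵀ, let P be a Moore–Penrose pseudoinverse of C, and let Q be a Moore–Penrose pseudoinverse of A. Then for each k ∈ {1,…,m}, P Ā_k = d_kk⁻¹ · (Q_{k·})ᵀ, where Ā_k is the entrywise conjugate of the k-th column of A and Q_{k·} is the k-th row of Q. Moreover (P Ā_k)ᵀ A_k = d_kk⁻¹. -/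
open Matrix

/-- A Moore–Penrose pseudoinverse is unique. -/
theorem moorePenrose_unique {R ι κ : Type*} [CommRing R] [StarRing R] [Fintype ι] [Fintype κ]
    {M : Matrix ι κ R} {X Y : Matrix κ ι R}
    (hX1 : M * X * M = M) (hX2 : X * M * X = X) (hX3 : (M * X)ᴴ = M * X) (hX4 : (X * M)ᴴ = X * M)
    (hY1 : M * Y * M = M) (hY2 : Y * M * Y = Y) (hY3 : (M * Y)ᴴ = M * Y) (hY4 : (Y * M)ᴴ = Y * M) :
    X = Y := by
  have hl : M * X = M * Y := by
    calc M * X = (M * X)ᴴ := hX3.symm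
      _ = (M * Y * (M * X))ᴴ := by rw [← Matrix.mul_assoc, hY1]
      _ = M * X * (M * Y) := by rw [conjTranspose_mul, hX3, hY3]
      _ = M * Y := by rw [← Matrix.mul_assoc, hX1]
  have hr : X * M = Y * M := by
    calc X * M = (X * M)ᴴ := hX4.symm
      _ = (X * M * (Y * M))ᴴ := by
        rw [Matrix.mul_assoc X, ← Matrix.mul_assoc M, hY1]
      _ = Y * M * (X * M) := by rw [conjTranspose_mul, hX4, hY4]
      _ = Y * M := by rw [Matrix.mul_assoc Y, ← Matrix.mul_assoc M, hX1]
  rw [← hX2, Matrix.mul_assoc, hl, ← Matrix.mul_assoc, hr, hY2]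

/-- A generalized inverse of a matrix with linearly independent columns is a left inverse. -/
theorem mul_eq_one_of_linearIndependent_col {K ι κ : Type*} [Field K] [Fintype ι] [Fintype κ]
    [DecidableEq κ] {A : Matrix ι κ K} {Q : Matrix κ ι K}
    (hA : LinearIndependent K (fun j => Aᵀ j)) (hQ : A * Q * A = A) : Q * A = 1 := by
  have hinj : Function.Injective A.mulVec := mulVec_injective_iff.2 hA
  refine ext_of_mulVec_single fun j => hinj ?_
  rw [mulVec_mulVec, mulVec_mulVec, ← Matrix.mul_assoc, hQ, Matrix.mul_one]

/-- complex row recovery in PEGI. With `C = Ā D Aᵀ`, `P` a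
Moore–Penrose pseudoinverse of `C` and `Q` one of `A`:
`P Ā_k = d_kk⁻¹ (Q_{k·})ᵀ` and `(P Ā_k)ᵀ A_k = d_kk⁻¹`. -/
theorem stmt13 {n m : ℕ} (hmn : m ≤ n) (A : Matrix (Fin n) (Fin m) ℂ)
    (hA : LinearIndependent ℂ (fun j => Aᵀ j))
    (d : Fin m → ℝ) (hd : ∀ k, d k ≠ 0)
    (C P : Matrix (Fin n) (Fin n) ℂ)
    (hC : C = A.map star * Matrix.diagonal (fun k => (d k : ℂ)) * Aᵀ)
    (hP1 : C * P * C = C) (hP2 : P * C * P = P)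
    (hP3 : (C * P)ᴴ = C * P) (hP4 : (P * C)ᴴ = P * C)
    (Q : Matrix (Fin m) (Fin n) ℂ)
    (hQ1 : A * Q * A = A) (hQ2 : Q * A * Q = Q)
    (hQ3 : (A * Q)ᴴ = A * Q) (hQ4 : (Q * A)ᴴ = Q * A) :
    ∀ k : Fin m,
      P *ᵥ star (Aᵀ k) = (((d k)⁻¹ : ℝ) : ℂ) • Q k ∧
      (P *ᵥ star (Aᵀ k)) ⬝ᵥ Aᵀ k = (((d k)⁻¹ : ℝ) : ℂ) := by
  intro k
  have hQA : Q * A = 1 := mul_eq_one_of_linearIndependent_col hA hQ1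
  have hT : Aᵀ * Qᵀ = 1 := by rw [← transpose_mul, hQA, transpose_one]
  have hbar : Q.map star * A.map star = 1 := by
    have h := congrArg (fun M => (Mᴴ)ᵀ) hQA
    simpa [conjTranspose_mul, transpose_mul, conjTranspose, transpose_map] using h
  set D : Matrix (Fin m) (Fin m) ℂ := diagonal fun k => (d k : ℂ) with hD
  set E : Matrix (Fin m) (Fin m) ℂ := diagonal fun k => (((d k)⁻¹ : ℝ) : ℂ) with hE
  have hDE : D * E = 1 := by
    simp [hD, hE, hd]
  have hED : E * D = 1 := by
    simp [hD, hE, hd]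
  have hCR : C * (Qᵀ * E * Q.map star) = ((A * Q)ᴴ)ᵀ := by
    calc C * (Qᵀ * E * Q.map star)
        = A.map star * (D * (Aᵀ * Qᵀ) * E) * Q.map star := by
          rw [hC]; simp only [Matrix.mul_assoc]
      _ = ((A * Q)ᴴ)ᵀ := by
          rw [hT, Matrix.mul_one, hDE, Matrix.mul_one, conjTranspose_mul, transpose_mul]
          rfl
  have hRC : Qᵀ * E * Q.map star * C = (A * Q)ᵀ := by
    calc Qᵀ * E * Q.map star * C
        = Qᵀ * (E * (Q.map star * A.map star) * D) * Aᵀ := by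
          rw [hC]; simp only [Matrix.mul_assoc]
      _ = (A * Q)ᵀ := by
          rw [hbar, Matrix.mul_one, hED, Matrix.mul_one, transpose_mul]
  have hself : ((A * Q)ᵀ)ᴴ = (A * Q)ᵀ := congrArg transpose hQ3
  have hP : P = Qᵀ * E * Q.map star := by
    refine moorePenrose_unique hP1 hP2 hP3 hP4 ?_ ?_ ?_ ?_
    · rw [Matrix.mul_assoc, hRC, hC, Matrix.mul_assoc, ← transpose_mul, hQ1]
    · rw [hRC, Matrix.mul_assoc Qᵀ, ← Matrix.mul_assoc _ Qᵀ, ← transpose_mul,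
        ← Matrix.mul_assoc Q, hQ2]
    · rw [hCR, hQ3, hself]
    · rw [hRC, hself]
  have hrow : P *ᵥ star (Aᵀ k) = (((d k)⁻¹ : ℝ) : ℂ) • Q k := by
    have hcol : star (Aᵀ k) = A.map star *ᵥ Pi.single k 1 := by
      rw [mulVec_single_one]; rfl
    rw [hcol, hP, mulVec_mulVec, Matrix.mul_assoc, hbar, Matrix.mul_one, ← mulVec_mulVec,
      hE, diagonal_mulVec_single, mul_one]
    ext i
    simp [mul_comm]
  refine ⟨hrow, ?_⟩
  have hkk : Q k ⬝ᵥ Aᵀ k = 1 := by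
    have h := congrFun (congrFun hQA k) k
    rwa [one_apply_eq] at h
  rw [hrow, smul_dotProduct, hkk, smul_eq_mul, mul_one]
end
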